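/- Let W be smooth and frame invariant near I with W̃(G) = W(I+G). There exist ε, C > 0 such that for all 0 < h ≤ 1, all Z ∈ L^∞(Ω)^{d×d} with ‖Z‖_{L^∞} ≤ min(ε, h), and all Y₁ ∈ H¹(Ω)^{d×d}, Y₂ ∈ H^{1,0}(Ω)^{d×d}, Y₃ ∈ L²(Ω)^{d×d}: ‖D³W̃(Z)(Y₁,Y₂,Y₃)‖_{L¹(Ω)} ≤ C h ‖Y₁‖_{H¹_h(Ω)} ‖Y₂‖_{H^{1,0}_h(Ω)} ‖Y₃‖_{L²_h(Ω)}, where the subscript h indicates the norms built from the scaled matrix norm |A|_h. -/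

import Mathlib

/- STATEMENT 15: trilinear estimate for D³W̃: for frame-invariant smooth W near I there are
ε, C > 0 such that for 0 < h ≤ 1, ‖Z‖_{L^∞(Ω)} ≤ min(ε,h), and matrix fields Y₁, Y₂, Y₃,
‖D³W̃(Z)(Y₁,Y₂,Y₃)‖_{L¹(Ω)} ≤ C h ‖Y₁‖_{H¹_h} ‖Y₂‖_{H^{1,0}_h} ‖Y₃‖_{L²_h},
the subscript h indicating norms built from the scaled matrix norm |A|_h. -/

open MeasureTheory Set Matrix
noncomputable section

attribute [local instance] Matrix.frobeniusNormedAddCommGroup Matrix.frobeniusNormedSpace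

variable (d : ℕ) (L h : ℝ)

def OmegaTang : Set (Fin (d - 1) → ℝ) := {x' | ∀ i, x' i ∈ Ioo (-L) L}

def Iv : Set ℝ := Ioo (-(1/2) : ℝ) (1/2)

abbrev Dom (d : ℕ) := (Fin (d - 1) → ℝ) × ℝ

def OmegaSet : Set (Dom d) := (OmegaTang d L) ×ˢ Iv

def frobInner (A B : Matrix (Fin d) (Fin d) ℝ) : ℝ := ∑ i, ∑ j, A i j * B i j

def frobNorm (A : Matrix (Fin d) (Fin d) ℝ) : ℝ := Real.sqrt (frobInner d A A)

def symPart (A : Matrix (Fin d) (Fin d) ℝ) : Matrix (Fin d) (Fin d) ℝ := (1 / 2 : ℝ) • (A + Aᵀ)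

def skewPart (A : Matrix (Fin d) (Fin d) ℝ) : Matrix (Fin d) (Fin d) ℝ := (1 / 2 : ℝ) • (A - Aᵀ)

/-- scaled matrix norm `|A|_h`. -/
def hNorm (A : Matrix (Fin d) (Fin d) ℝ) : ℝ :=
  Real.sqrt (h⁻¹ ^ 2 * frobInner d (symPart d A) (symPart d A)
    + frobInner d (skewPart d A) (skewPart d A))

/-- tangential derivative of a matrix field, entrywise. -/
def dX (j : Fin (d - 1)) (Y : Dom d → Matrix (Fin d) (Fin d) ℝ) (p : Dom d) :
    Matrix (Fin d) (Fin d) ℝ :=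
  Matrix.of fun i k => fderiv ℝ (fun q => Y q i k) p (Pi.single j 1, 0)

/-- normal derivative of a matrix field, entrywise. -/
def dN (Y : Dom d → Matrix (Fin d) (Fin d) ℝ) (p : Dom d) : Matrix (Fin d) (Fin d) ℝ :=
  Matrix.of fun i k => fderiv ℝ (fun q => Y q i k) p (0, 1)

/-- squared L²_h(Ω) norm of a matrix field. -/
def L2hSq (Y : Dom d → Matrix (Fin d) (Fin d) ℝ) : ℝ :=
  ∫ p in OmegaSet d L, (hNorm d h (Y p)) ^ 2

/-- squared H^{1,0}_h(Ω) norm (tangential derivatives only). -/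
def H10hSq (Y : Dom d → Matrix (Fin d) (Fin d) ℝ) : ℝ :=
  L2hSq d L h Y + ∑ j, L2hSq d L h (dX d j Y)

/-- squared H¹_h(Ω) norm (all first derivatives). -/
def H1hSq (Y : Dom d → Matrix (Fin d) (Fin d) ℝ) : ℝ :=
  L2hSq d L h Y + ∑ j, L2hSq d L h (dX d j Y) + L2hSq d L h (dN d Y)

/-- CS -/
lemma cs_int {α : Type*} [MeasurableSpace α] (μ : Measure α) (f g : α → ℝ)
    (hf : Integrable (fun x => f x ^ 2) μ) (hg : Integrable (fun x => g x ^ 2) μ)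
    (hfg : Integrable (fun x => f x * g x) μ) :
    (∫ x, f x * g x ∂μ) ^ 2 ≤ (∫ x, f x ^ 2 ∂μ) * (∫ x, g x ^ 2 ∂μ) := by
  have key : ∀ s : ℝ, 0 ≤ (∫ x, g x ^ 2 ∂μ) * (s * s) + (2 * ∫ x, f x * g x ∂μ) * s + ∫ x, f x ^ 2 ∂μ := by
    intro s
    have h0 : 0 ≤ ∫ x, (f x + s * g x) ^ 2 ∂μ := integral_nonneg fun x => sq_nonneg _
    have : ∫ x, (f x + s * g x) ^ 2 ∂μ = ∫ x, ((g x ^ 2 * (s * s) + (f x * g x) * (2 * s)) + f x ^ 2) ∂μ := by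
      congr 1; ext x; ring
    have i1 : Integrable (fun x => g x ^ 2 * (s * s)) μ := hg.mul_const _
    have i2 : Integrable (fun x => (f x * g x) * (2 * s)) μ := hfg.mul_const _
    have i3 : Integrable (fun x => g x ^ 2 * (s * s) + (f x * g x) * (2 * s)) μ := i1.add i2
    rw [this, integral_add i3 hf,
      integral_add i1 i2, integral_mul_const, integral_mul_const] at h0
    linarith
  have := discrim_le_zero key
  unfold discrim at this
  nlinarith

/-- infinitesimal frame invariance -/
lemma frame_deriv (r : ℝ) 
    (W : Matrix (Fin d) (Fin d) ℝ → ℝ)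
    (hW : ContDiffOn ℝ (⊤ : ℕ∞) W (Metric.ball (1 : Matrix (Fin d) (Fin d) ℝ) r))
    (hframe : ∀ R F : Matrix (Fin d) (Fin d) ℝ, Rᵀ * R = 1 → R.det = 1 →
      F ∈ Metric.ball (1 : Matrix (Fin d) (Fin d) ℝ) r →
      R * F ∈ Metric.ball (1 : Matrix (Fin d) (Fin d) ℝ) r →
      W (R * F) = W F) (A F : Matrix (Fin d) (Fin d) ℝ) (hA : Aᵀ = -A)
      (hF : F ∈ Metric.ball (1 : Matrix (Fin d) (Fin d) ℝ) r) :
    fderiv ℝ W F (A * F) = 0 := by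
  let _ := Matrix.frobeniusNormedRing (m := Fin d) (α := ℝ)
  let _ := Matrix.frobeniusNormedAlgebra (m := Fin d) (R := ℝ) (α := ℝ)
  have horth : ∀ s : ℝ, (NormedSpace.exp (s • A))ᵀ * NormedSpace.exp (s • A) = 1 := by
    intro s
    rw [← Matrix.exp_transpose, Matrix.transpose_smul, hA, smul_neg,
      ← Matrix.exp_add_of_commute (-(s • A)) (s • A) (Commute.neg_left (Commute.refl _))]
    simp
  have hdet : ∀ s : ℝ, (NormedSpace.exp (s • A)).det = 1 := by
    intro s
    have h1 : s • A = (s/2) • A + (s/2) • A := by rw [← add_smul]; ring_nf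
    rw [h1, Matrix.exp_add_of_commute _ _ (Commute.refl _)]
    have := congrArg Matrix.det (horth (s/2))
    simpa using this
  have hd : HasDerivAt (fun s : ℝ => NormedSpace.exp (s • A) * F) (A * F) 0 := by
    have := (hasDerivAt_exp_smul_const (𝕂 := ℝ) A (0:ℝ)).mul_const F
    simp only [zero_smul, NormedSpace.exp_zero, one_mul] at this
    exact this
  have hWF : HasFDerivAt W (fderiv ℝ W F) F :=
    ((hW.contDiffAt (Metric.isOpen_ball.mem_nhds hF)).differentiableAt (by simp)).hasFDerivAt
  have hWF' : HasFDerivAt W (fderiv ℝ W F) (NormedSpace.exp ((0:ℝ) • A) * F) := by simpa using hWF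
  have hc := hWF'.comp_hasDerivAt (0:ℝ) hd
  have hev : (W ∘ fun s : ℝ => NormedSpace.exp (s • A) * F) =ᶠ[nhds 0] fun _ => W F := by
    have := hd.continuousAt.preimage_mem_nhds (t := Metric.ball (1 : Matrix (Fin d) (Fin d) ℝ) r)
      (by simpa using Metric.isOpen_ball.mem_nhds hF)
    filter_upwards [this] with s hs
    exact hframe _ _ (horth s) (hdet s) hF hs
  exact hc.unique ((hasDerivAt_const (0:ℝ) (W F)).congr_of_eventuallyEq hev)

lemma d3_eq {E : Type*} [NormedAddCommGroup E] [NormedSpace ℝ E] (V : E → ℝ) (z a b c : E) :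
    iteratedFDeriv ℝ 3 V z ![a,b,c] = fderiv ℝ (fderiv ℝ (fderiv ℝ V)) z a b c := by
  rw [iteratedFDeriv_succ_apply_right, iteratedFDeriv_two_apply]
  rfl

/-- `D³V(0)` vanishes on skew triples. -/
lemma d3_skew {E : Type*} [NormedRing E] [NormedAlgebra ℝ E] (r : ℝ) (hr : 0 < r)
    (V : E → ℝ) (S : Set E)
    (hV : ContDiffOn ℝ (⊤ : ℕ∞) V (Metric.ball (0 : E) r))
    (hinf : ∀ A ∈ S, ∀ G ∈ Metric.ball (0 : E) r, fderiv ℝ V G (A * (1 + G)) = 0)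
    (hS : ∀ A ∈ S, ∀ B ∈ S, ∀ C ∈ S, B * (A * C) + C * (A * B) ∈ S)
    (A B C : E) (hA : A ∈ S) (hB : B ∈ S) (hC : C ∈ S) :
    fderiv ℝ (fderiv ℝ (fderiv ℝ V)) 0 C B A = 0 := by
  have hnb : Metric.ball (0 : E) r ∈ nhds 0 := Metric.ball_mem_nhds _ hr
  have hcd : ∀ G ∈ Metric.ball (0 : E) r, ContDiffAt ℝ 4 V G := fun G hG =>
    (hV.contDiffAt (Metric.isOpen_ball.mem_nhds hG)).of_le (WithTop.coe_le_coe.2 (le_top : (4:ℕ∞) ≤ ⊤))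
  have hcd1 : ∀ G ∈ Metric.ball (0 : E) r, ContDiffAt ℝ 3 (fderiv ℝ V) G :=
    fun G hG => (hcd G hG).fderiv_right (by norm_num)
  have hcd2 : ∀ G ∈ Metric.ball (0 : E) r,
      ContDiffAt ℝ 2 (fderiv ℝ (fderiv ℝ V)) G :=
    fun G hG => (hcd1 G hG).fderiv_right (by norm_num)
  have hmul : ∀ A G : E, HasFDerivAt (fun G : E => A * (1 + G))
      (ContinuousLinearMap.mul ℝ E A) G := by
    intro A G
    have h1 := (ContinuousLinearMap.mul ℝ E A).hasFDerivAt (x := G)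
    have h2 := h1.const_add (A * 1)
    refine h2.congr_of_eventuallyEq (Filter.Eventually.of_forall fun G => ?_)
    simp [mul_add]
  have e1 : ∀ A ∈ S, ∀ B, ∀ G ∈ Metric.ball (0 : E) r,
      fderiv ℝ (fderiv ℝ V) G B (A * (1 + G)) + fderiv ℝ V G (A * B) = 0 := by
    intro A hA B G hG
    have hd := (((hcd1 G hG).differentiableAt (by norm_num)).hasFDerivAt).clm_apply (hmul A G)
    have hev : (fun G => fderiv ℝ V G (A * (1 + G))) =ᶠ[nhds G] fun _ => 0 := by
      filter_upwards [Metric.isOpen_ball.mem_nhds hG] with G' hG'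
      exact hinf A hA G' hG'
    have := hd.unique ((hasFDerivAt_const (0:ℝ) G).congr_of_eventuallyEq hev)
    have h2 := congrArg (fun T => T B) this
    simp at h2
    linarith
  have h0 : (0 : E) ∈ Metric.ball (0 : E) r := Metric.mem_ball_self hr
  have e2 : fderiv ℝ (fderiv ℝ (fderiv ℝ V)) 0 C B A + fderiv ℝ (fderiv ℝ V) 0 B (A * C)
      + fderiv ℝ (fderiv ℝ V) 0 C (A * B) = 0 := by
    have hd1 := ((((hcd2 0 h0).differentiableAt (by norm_num)).hasFDerivAt).clm_apply
      (hasFDerivAt_const B 0)).clm_apply (hmul A 0)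
    have hd2 := (((hcd1 0 h0).differentiableAt (by norm_num)).hasFDerivAt).clm_apply
      (hasFDerivAt_const (A * B) 0)
    have hd := hd1.add hd2
    have hev : ((fun G => fderiv ℝ (fderiv ℝ V) G B (A * (1 + G))) + fun G => fderiv ℝ V G (A * B))
        =ᶠ[nhds 0] fun _ => 0 := by
      filter_upwards [hnb] with G' hG'
      exact e1 A hA B G' hG'
    have := hd.unique ((hasFDerivAt_const (0:ℝ) 0).congr_of_eventuallyEq hev)
    have h2 := congrArg (fun T => T C) this
    simp at h2
    linarith
  have hs : IsSymmSndFDerivAt ℝ V 0 := (hcd 0 h0).isSymmSndFDerivAt (by simp; norm_num)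
  have f1 := e1 B hB (A * C) 0 h0
  have f2 := e1 C hC (A * B) 0 h0
  have f3 := hinf (B * (A * C) + C * (A * B)) (hS A hA B hB C hC) 0 h0
  have s1 := hs B (A * C)
  have s2 := hs C (A * B)
  simp only [add_zero, mul_one, map_add] at f1 f2 f3
  linarith

set_option maxSynthPendingDepth 3 in
/-- abstract pointwise bound -/
lemma pointwise_abs {E : Type*} [NormedRing E] [NormedAlgebra ℝ E] (r : ℝ) (hr : 0 < r)
    (V : E → ℝ) (S : Set E)
    (hV : ContDiffOn ℝ (⊤ : ℕ∞) V (Metric.ball (0 : E) r))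
    (hinf : ∀ A ∈ S, ∀ G ∈ Metric.ball (0 : E) r, fderiv ℝ V G (A * (1 + G)) = 0)
    (hS : ∀ A ∈ S, ∀ B ∈ S, ∀ C ∈ S, B * (A * C) + C * (A * B) ∈ S) :
    ∃ ε > (0 : ℝ), ∃ C > (0 : ℝ), ∀ h : ℝ, 0 < h → h ≤ 1 → ∀ Z : E, ‖Z‖ ≤ min ε h →
      ∀ (s₁ s₂ s₃ k₁ k₂ k₃ : E) (a b c : ℝ), k₁ ∈ S → k₂ ∈ S → k₃ ∈ S →
      ‖s₁‖ ≤ h * a → ‖s₂‖ ≤ h * b → ‖s₃‖ ≤ h * c → ‖k₁‖ ≤ a → ‖k₂‖ ≤ b → ‖k₃‖ ≤ c →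
      |iteratedFDeriv ℝ 3 V Z ![s₁ + k₁, s₂ + k₂, s₃ + k₃]| ≤ C * h * (a * b * c) := by
  have hcd : ContDiffAt ℝ 4 V 0 :=
    (hV.contDiffAt (Metric.ball_mem_nhds _ hr)).of_le (WithTop.coe_le_coe.2 (le_top : (4:ℕ∞) ≤ ⊤))
  have hcd1 : ContDiffAt ℝ 3 (fderiv ℝ V) 0 := hcd.fderiv_right (by norm_num)
  have hcd2 : ContDiffAt ℝ 2 (fderiv ℝ (fderiv ℝ V)) 0 := hcd1.fderiv_right (by norm_num)
  have hcd3 : ContDiffAt ℝ 1 (fderiv ℝ (fderiv ℝ (fderiv ℝ V))) 0 :=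
    hcd2.fderiv_right (by norm_num)
  obtain ⟨K, t, ht, hK⟩ := hcd3.exists_lipschitzOnWith
  obtain ⟨ε, hε, hball⟩ := Metric.mem_nhds_iff.1 ht
  set T := fderiv ℝ (fderiv ℝ (fderiv ℝ V)) with hT
  refine ⟨ε / 2, by positivity, 8 * K + 12 * ‖T 0‖ + 1, by positivity, ?_⟩
  intro h hh h1 Z hZ s₁ s₂ s₃ k₁ k₂ k₃ a b c hk₁ hk₂ hk₃ hsa hsb hsc hka hkb hkc
  rw [d3_eq]
  have hZε := hZ.trans (min_le_left _ _)
  have hZh := hZ.trans (min_le_right _ _)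
  have hdiff : ‖T Z - T 0‖ ≤ K * h := by
    have := hK.dist_le_mul Z (hball (by simp; linarith)) 0 (hball (by simpa using hε))
    rw [dist_eq_norm, dist_zero_right] at this
    exact this.trans (by gcongr)
  have hY : ∀ (s k : E) (a : ℝ), ‖s‖ ≤ h * a → ‖k‖ ≤ a → ‖s + k‖ ≤ 2 * a := by
    intro s k a hs hk
    have := norm_add_le s k
    have := (norm_nonneg k).trans hk
    nlinarith
  have hbd : ∀ (S : E →L[ℝ] E →L[ℝ] E →L[ℝ] ℝ) (a b c : E) (α β γ : ℝ), ‖a‖ ≤ α → ‖b‖ ≤ β → ‖c‖ ≤ γ → |S a b c| ≤ ‖S‖ * α * β * γ := by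
    intro S a b c α β γ ha hb hc
    have := (S a).le_opNorm₂ b c
    rw [Real.norm_eq_abs] at this
    refine this.trans ?_
    have h2 := S.le_opNorm a
    have := norm_nonneg a
    have := norm_nonneg b
    have := norm_nonneg c
    calc ‖S a‖ * ‖b‖ * ‖c‖ ≤ (‖S‖ * ‖a‖) * ‖b‖ * ‖c‖ := by gcongr
      _ ≤ _ := by
        have hα : 0 ≤ α := by linarith
        have hβ : 0 ≤ β := by linarith
        gcongr
  have hdec : T Z (s₁ + k₁) (s₂ + k₂) (s₃ + k₃) = (T Z - T 0) (s₁ + k₁) (s₂ + k₂) (s₃ + k₃)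
      + T 0 s₁ (s₂ + k₂) (s₃ + k₃) + T 0 k₁ s₂ (s₃ + k₃) + T 0 k₁ k₂ s₃ := by
    have hz := d3_skew r hr V S hV hinf hS k₃ k₂ k₁ hk₃ hk₂ hk₁
    simp only [_root_.sub_apply, map_add, _root_.add_apply]
    linarith
  have b0 := hbd (T Z - T 0) _ _ _ _ _ _ (hY _ _ _ hsa hka) (hY _ _ _ hsb hkb) (hY _ _ _ hsc hkc)
  have b1 := hbd (T 0) _ _ _ _ _ _ hsa (hY _ _ _ hsb hkb) (hY _ _ _ hsc hkc)
  have b2 := hbd (T 0) _ _ _ _ _ _ hka hsb (hY _ _ _ hsc hkc)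
  have b3 := hbd (T 0) _ _ _ _ _ _ hka hkb hsc
  have ha := (norm_nonneg _).trans hka
  have hb := (norm_nonneg _).trans hkb
  have hc := (norm_nonneg _).trans hkc
  set P := a * b * c with hP
  have hP0 : 0 ≤ P := by positivity
  have c0 : ‖T Z - T 0‖ * (2 * a) * (2 * b) * (2 * c) ≤ 8 * K * h * P := by
    calc _ = ‖T Z - T 0‖ * (8 * P) := by rw [hP]; ring
      _ ≤ (K * h) * (8 * P) := by gcongr
      _ = _ := by ring
  have c1 : |T Z (s₁ + k₁) (s₂ + k₂) (s₃ + k₃)| ≤ 8 * K * h * P + 4 * ‖T 0‖ * h * P + 2 * ‖T 0‖ * h * P + ‖T 0‖ * h * P := by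
    rw [hdec]
    refine (abs_add_le _ _).trans (add_le_add ((abs_add_le _ _).trans (add_le_add ((abs_add_le _ _).trans (add_le_add (b0.trans c0) (b1.trans ?_))) (b2.trans ?_))) (b3.trans ?_))
    all_goals (rw [hP]; apply le_of_eq; ring)
  have : 0 ≤ ‖T 0‖ * h * P := by positivity
  have : 0 ≤ h * P := by positivity
  linarith

lemma frobNorm_eq (A : Matrix (Fin d) (Fin d) ℝ) : frobNorm d A = ‖A‖ := by
  rw [Matrix.frobenius_norm_def, frobNorm, frobInner, Real.sqrt_eq_rpow]
  simp [sq]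

lemma frobInner_nonneg (A : Matrix (Fin d) (Fin d) ℝ) : 0 ≤ frobInner d A A :=
  Finset.sum_nonneg fun _ _ => Finset.sum_nonneg fun _ _ => mul_self_nonneg _

lemma norm_sym_le (hh : 0 < h) (A : Matrix (Fin d) (Fin d) ℝ) : ‖symPart d A‖ ≤ h * hNorm d h A := by
  rw [← frobNorm_eq, frobNorm, hNorm]
  have h1 := frobInner_nonneg d (symPart d A)
  have h2 := frobInner_nonneg d (skewPart d A)
  apply Real.sqrt_le_iff.2 ⟨by positivity, ?_⟩
  rw [mul_pow, Real.sq_sqrt (by positivity), mul_add]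
  have : h ^ 2 * (h⁻¹ ^ 2 * frobInner d (symPart d A) (symPart d A)) = frobInner d (symPart d A) (symPart d A) := by
    field_simp
  rw [this]
  have : 0 ≤ h ^ 2 * frobInner d (skewPart d A) (skewPart d A) := by positivity
  linarith

lemma norm_skew_le (A : Matrix (Fin d) (Fin d) ℝ) : ‖skewPart d A‖ ≤ hNorm d h A := by
  rw [← frobNorm_eq, frobNorm, hNorm]
  have h1 := frobInner_nonneg d (symPart d A)
  apply Real.sqrt_le_sqrt
  have : 0 ≤ h⁻¹ ^ 2 * frobInner d (symPart d A) (symPart d A) := by positivity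
  linarith

lemma sym_add_skew (A : Matrix (Fin d) (Fin d) ℝ) : symPart d A + skewPart d A = A := by
  ext i j; simp [symPart, skewPart]; ring

lemma skew_transpose (A : Matrix (Fin d) (Fin d) ℝ) : (skewPart d A)ᵀ = - skewPart d A := by
  ext i j; simp [skewPart]; ring

/-- pointwise bound -/
lemma pointwise (r : ℝ) (hr : 0 < r)
    (W : Matrix (Fin d) (Fin d) ℝ → ℝ)
    (hW : ContDiffOn ℝ (⊤ : ℕ∞) W (Metric.ball (1 : Matrix (Fin d) (Fin d) ℝ) r))
    (hframe : ∀ R F : Matrix (Fin d) (Fin d) ℝ, Rᵀ * R = 1 → R.det = 1 →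
      F ∈ Metric.ball (1 : Matrix (Fin d) (Fin d) ℝ) r →
      R * F ∈ Metric.ball (1 : Matrix (Fin d) (Fin d) ℝ) r →
      W (R * F) = W F) :
    ∃ ε > (0 : ℝ), ∃ C > (0 : ℝ), ∀ h : ℝ, 0 < h → h ≤ 1 →
      ∀ Z Y₁ Y₂ Y₃ : Matrix (Fin d) (Fin d) ℝ, frobNorm d Z ≤ min ε h →
      |iteratedFDeriv ℝ 3 (fun G => W (1 + G)) Z ![Y₁, Y₂, Y₃]| ≤ 
        C * h * (hNorm d h Y₁ * hNorm d h Y₂ * hNorm d h Y₃) := by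
  have hmaps : ∀ G ∈ Metric.ball (0 : Matrix (Fin d) (Fin d) ℝ) r, 
      1 + G ∈ Metric.ball (1 : Matrix (Fin d) (Fin d) ℝ) r := by
    intro G hG
    simpa [dist_eq_norm] using hG
  have hV : ContDiffOn ℝ (⊤ : ℕ∞) (fun G => W (1 + G)) (Metric.ball (0 : Matrix (Fin d) (Fin d) ℝ) r) :=
    hW.comp (contDiff_const.add contDiff_id).contDiffOn hmaps
  have hinf : ∀ A ∈ {A : Matrix (Fin d) (Fin d) ℝ | Aᵀ = -A}, 
      ∀ G ∈ Metric.ball (0 : Matrix (Fin d) (Fin d) ℝ) r, fderiv ℝ (fun G => W (1 + G)) G (A * (1 + G)) = 0 := by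
    intro A hA G hG
    have e : fderiv ℝ (fun G => W (1 + G)) G = fderiv ℝ W (1 + G) :=
      fderiv_comp_add_left (𝕜 := ℝ) (f := W) (x := G) 1
    rw [e]
    exact frame_deriv d r W hW hframe A _ hA (hmaps G hG)
  have hS : ∀ A ∈ {A : Matrix (Fin d) (Fin d) ℝ | Aᵀ = -A}, ∀ B ∈ {A : Matrix (Fin d) (Fin d) ℝ | Aᵀ = -A},
     ∀ C ∈ {A : Matrix (Fin d) (Fin d) ℝ | Aᵀ = -A}, 
      B * (A * C) + C * (A * B) ∈ {A : Matrix (Fin d) (Fin d) ℝ | Aᵀ = -A} := by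
    intro A hA B hB C hC
    simp only [mem_ofPred_eq] at *
    simp only [Matrix.transpose_add, Matrix.transpose_mul, hA, hB, hC]
    noncomm_ring
  obtain ⟨ε, hε, C, hC, hmain⟩ := @pointwise_abs _ (Matrix.frobeniusNormedRing (m := Fin d) (α := ℝ))
    (Matrix.frobeniusNormedAlgebra (m := Fin d) (R := ℝ) (α := ℝ)) r hr _ _ hV hinf hS
  refine ⟨ε, hε, C, hC, ?_⟩
  intro h hh h1 Z Y₁ Y₂ Y₃ hZ
  rw [frobNorm_eq] at hZ
  have := hmain h hh h1 Z hZ (symPart d Y₁) (symPart d Y₂) (symPart d Y₃) 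
    (skewPart d Y₁) (skewPart d Y₂) (skewPart d Y₃) _ _ _ (skew_transpose d _) (skew_transpose d _) (skew_transpose d _)
    (norm_sym_le d h hh Y₁) (norm_sym_le d h hh Y₂) (norm_sym_le d h hh Y₃)
    (norm_skew_le d h Y₁) (norm_skew_le d h Y₂) (norm_skew_le d h Y₃)
  simp only [sym_add_skew] at this
  exact this

/-- Lebesgue measure on an interval. -/
def Jm (a b : ℝ) : Measure ℝ := volume.restrict (Icc a b)

instance (a b : ℝ) : IsFiniteMeasure (Jm a b) := by unfold Jm; infer_instance

lemma cint1 {F : ℝ → ℝ} (hF : Continuous F) (a b : ℝ) : Integrable F (Jm a b) :=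
  hF.integrableOn_Icc

lemma cint2 {F : ℝ × ℝ → ℝ} (hF : Continuous F) (a b a' b' : ℝ) :
    Integrable F ((Jm a b).prod (Jm a' b')) := by
  unfold Jm
  rw [Measure.prod_restrict]
  exact hF.continuousOn.integrableOn_compact (isCompact_Icc.prod isCompact_Icc)

lemma cint3 {F : (ℝ × ℝ) × ℝ → ℝ} (hF : Continuous F) (a b a' b' a'' b'' : ℝ) :
    Integrable F (((Jm a b).prod (Jm a' b')).prod (Jm a'' b'')) := by
  unfold Jm
  rw [Measure.prod_restrict, Measure.prod_restrict]
  exact hF.continuousOn.integrableOn_compact ((isCompact_Icc.prod isCompact_Icc).prod isCompact_Icc)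

lemma oneD {a b : ℝ} (hab : a < b) {u u' : ℝ → ℝ} (hu : Continuous u) (hu' : Continuous u')
    (hd : ∀ x, HasDerivAt u (u' x) x) {x : ℝ} (hx : x ∈ Icc a b) :
    |u x| ≤ ∫ y, ((b - a)⁻¹ * |u y| + |u' y|) ∂(Jm a b) := by
  have h1 : ∀ y ∈ Icc a b, |u x| ≤ |u y| + ∫ s, |u' s| ∂(Jm a b) := by
    intro y hy
    have e : ∫ s in y..x, u' s = u x - u y :=
      intervalIntegral.integral_eq_sub_of_hasDerivAt (fun s _ => hd s) (hu'.intervalIntegrable _ _)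
    have h2 : |u x - u y| ≤ ∫ s, |u' s| ∂(Jm a b) := by
      rw [← e]
      have := intervalIntegral.norm_integral_le_integral_norm_uIoc (f := u') (μ := volume) (a := y) (b := x)
      refine this.trans ?_
      unfold Jm
      refine setIntegral_mono_set hu'.abs.integrableOn_Icc (Filter.Eventually.of_forall fun _ => abs_nonneg _) ?_
      refine LE.le.eventuallyLE ?_
      exact uIoc_subset_uIcc.trans (uIcc_subset_Icc hy hx)
    have := abs_sub_abs_le_abs_sub (u x) (u y)
    linarith
  have hba : 0 < b - a := by linarith
  have h3 : ∫ y, |u x| ∂(Jm a b) ≤ ∫ y, (|u y| + ∫ s, |u' s| ∂(Jm a b)) ∂(Jm a b) := by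
    refine setIntegral_mono_on (by simp) ?_ measurableSet_Icc h1
    exact cint1 (by fun_prop) a b
  have hJ : (Jm a b).real univ = b - a := by simp [Jm, hab.le]
  rw [integral_add (cint1 (by fun_prop) a b) (cint1 (by fun_prop) a b), integral_const, integral_const, hJ] at h3
  rw [integral_add (cint1 (by fun_prop) a b) (cint1 (by fun_prop) a b), integral_const_mul]
  simp only [smul_eq_mul] at h3
  have : |u x| = (b - a)⁻¹ * ((b - a) * |u x|) := by field_simp
  rw [this]
  calc _ ≤ (b - a)⁻¹ * (∫ y, |u y| ∂(Jm a b) + (b - a) * ∫ s, |u' s| ∂(Jm a b)) := by gcongr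
    _ = _ := by field_simp

lemma twoD {a b : ℝ} (hab : a < b) {v vx vy : ℝ × ℝ → ℝ} (hv : Continuous v) (hvx : Continuous vx)
    (hvy : Continuous vy)
    (hdx : ∀ x y, HasDerivAt (fun s => v (s, y)) (vx (x, y)) x)
    (hdy : ∀ x y, HasDerivAt (fun s => v (x, s)) (vy (x, y)) y) :
    ∫ p, v p ^ 2 ∂((Jm a b).prod (Jm a b)) ≤
      (∫ p, ((b - a)⁻¹ * |v p| + |vx p|) ∂((Jm a b).prod (Jm a b))) *
      (∫ p, ((b - a)⁻¹ * |v p| + |vy p|) ∂((Jm a b).prod (Jm a b))) := by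
  have ix : Integrable (fun p => (b - a)⁻¹ * |v p| + |vx p|) ((Jm a b).prod (Jm a b)) :=
    cint2 (by fun_prop) _ _ _ _
  have iy : Integrable (fun p => (b - a)⁻¹ * |v p| + |vy p|) ((Jm a b).prod (Jm a b)) :=
    cint2 (by fun_prop) _ _ _ _
  rw [integral_prod_symm _ ix, integral_prod _ iy, mul_comm, ← integral_prod_mul]
  refine integral_mono_of_nonneg (Filter.Eventually.of_forall fun _ => sq_nonneg _) ?_ ?_
  · exact Integrable.mul_prod iy.integral_prod_left ix.integral_prod_right
  · unfold Jm
    rw [Measure.prod_restrict]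
    refine (ae_restrict_iff' (measurableSet_Icc.prod measurableSet_Icc)).2 (Filter.Eventually.of_forall ?_)
    rintro ⟨x, y⟩ ⟨hx, hy⟩
    have e1 := oneD hab (u := fun s => v (s, y)) (u' := fun s => vx (s, y)) (by fun_prop) (by fun_prop) (fun x => hdx x y) hx
    have e2 := oneD hab (u := fun s => v (x, s)) (u' := fun s => vy (x, s)) (by fun_prop) (by fun_prop) (fun y => hdy x y) hy
    simp only
    rw [← sq_abs, sq]
    exact mul_le_mul e2 e1 (abs_nonneg _) ((abs_nonneg _).trans e2)

lemma slice4 {a b : ℝ} (hab : a < b) {v vx vy : ℝ × ℝ → ℝ} (hv : Continuous v) (hvx : Continuous vx)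
    (hvy : Continuous vy)
    (hdx : ∀ x y, HasDerivAt (fun s => v (s, y)) (vx (x, y)) x)
    (hdy : ∀ x y, HasDerivAt (fun s => v (x, s)) (vy (x, y)) y) :
    ∫ p, v p ^ 4 ∂((Jm a b).prod (Jm a b)) ≤
      (((b - a)⁻¹ + 1) * ∫ p, (v p ^ 2 + vx p ^ 2 + vy p ^ 2) ∂((Jm a b).prod (Jm a b))) ^ 2 := by
  have h := twoD hab (v := fun p => v p ^ 2) (vx := fun p => 2 * v p * vx p)
    (vy := fun p => 2 * v p * vy p) (by fun_prop) (by fun_prop) (by fun_prop)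
    (fun x y => by simpa using (hdx x y).fun_pow 2) (fun x y => by simpa using (hdy x y).fun_pow 2)
  have hba : 0 < b - a := by linarith
  set c := (b - a)⁻¹ with hc
  have hc0 : 0 < c := by positivity
  have key : ∀ w : ℝ × ℝ → ℝ, Continuous w → (∀ p, w p ^ 2 ≤ vx p ^ 2 + vy p ^ 2) →
      ∫ p, (c * |v p ^ 2| + |2 * v p * w p|) ∂((Jm a b).prod (Jm a b)) ≤
      (c + 1) * ∫ p, (v p ^ 2 + vx p ^ 2 + vy p ^ 2) ∂((Jm a b).prod (Jm a b)) := by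
    intro w hw hle
    rw [← integral_const_mul]
    refine integral_mono (cint2 (by fun_prop) _ _ _ _) (cint2 (by fun_prop) _ _ _ _) fun p => ?_
    simp only
    have h1 := hle p
    have h2 := sq_nonneg (|v p| - |w p|)
    have h3 := sq_abs (v p)
    have h4 := sq_abs (w p)
    rw [abs_of_nonneg (sq_nonneg (v p)), abs_mul, abs_mul, abs_two]
    have : 0 ≤ c * (vx p ^ 2 + vy p ^ 2) := by positivity
    nlinarith
  have k1 := key vx hvx (fun p => by nlinarith [sq_nonneg (vy p)])
  have k2 := key vy hvy (fun p => by nlinarith [sq_nonneg (vx p)])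
  calc ∫ p, v p ^ 4 ∂((Jm a b).prod (Jm a b)) = ∫ p, (v p ^ 2) ^ 2 ∂((Jm a b).prod (Jm a b)) := by
        congr 1; ext p; ring
    _ ≤ _ := h
    _ ≤ _ := by
      rw [sq]
      refine mul_le_mul k1 k2 (integral_nonneg fun p => by positivity) ?_
      exact mul_nonneg (by positivity) (integral_nonneg fun p => by positivity)

lemma slice6 {a b : ℝ} (hab : a < b) {v vx vy : ℝ × ℝ → ℝ} (hv : Continuous v) (hvx : Continuous vx)
    (hvy : Continuous vy)
    (hdx : ∀ x y, HasDerivAt (fun s => v (s, y)) (vx (x, y)) x)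
    (hdy : ∀ x y, HasDerivAt (fun s => v (x, s)) (vy (x, y)) y) :
    ∫ p, v p ^ 6 ∂((Jm a b).prod (Jm a b)) ≤
      (2 * ((b - a)⁻¹ ^ 2 + 9)) * (∫ p, v p ^ 4 ∂((Jm a b).prod (Jm a b))) *
        ∫ p, (v p ^ 2 + vx p ^ 2 + vy p ^ 2) ∂((Jm a b).prod (Jm a b)) := by
  have h := twoD hab (v := fun p => v p ^ 3) (vx := fun p => 3 * v p ^ 2 * vx p)
    (vy := fun p => 3 * v p ^ 2 * vy p) (by fun_prop) (by fun_prop) (by fun_prop)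
    (fun x y => by simpa using (hdx x y).fun_pow 3) (fun x y => by simpa using (hdy x y).fun_pow 3)
  have hba : 0 < b - a := by linarith
  set c := (b - a)⁻¹ with hc
  have hc0 : 0 < c := by positivity
  set Q := (2 * (c ^ 2 + 9)) * (∫ p, v p ^ 4 ∂((Jm a b).prod (Jm a b))) *
        ∫ p, (v p ^ 2 + vx p ^ 2 + vy p ^ 2) ∂((Jm a b).prod (Jm a b)) with hQ
  have hQ0 : 0 ≤ Q := mul_nonneg (mul_nonneg (by positivity) (integral_nonneg fun p => by positivity)) 
    (integral_nonneg fun p => by positivity)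
  have key : ∀ w : ℝ × ℝ → ℝ, Continuous w → (∀ p, w p ^ 2 ≤ vx p ^ 2 + vy p ^ 2) →
      (∫ p, (c * |v p ^ 3| + |3 * v p ^ 2 * w p|) ∂((Jm a b).prod (Jm a b))) ^ 2 ≤ Q := by
    intro w hw hle
    have e : ∀ p, c * |v p ^ 3| + |3 * v p ^ 2 * w p| = v p ^ 2 * (c * |v p| + 3 * |w p|) := by
      intro p
      rw [abs_pow, abs_mul, abs_mul, abs_pow, abs_of_pos (by norm_num : (0:ℝ) < 3), ← sq_abs (v p)]
      ring
    simp only [e]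
    refine (cs_int _ _ _ (cint2 (by fun_prop) _ _ _ _) (cint2 (by fun_prop) _ _ _ _)
      (cint2 (by fun_prop) _ _ _ _)).trans ?_
    have e4 : ∫ p, (v p ^ 2) ^ 2 ∂((Jm a b).prod (Jm a b)) = ∫ p, v p ^ 4 ∂((Jm a b).prod (Jm a b)) := by
      congr 1; ext p; ring
    rw [e4, hQ, mul_assoc, mul_left_comm]
    refine mul_le_mul_of_nonneg_left ?_ (integral_nonneg fun p => by positivity)
    rw [← integral_const_mul]
    refine integral_mono (cint2 (by fun_prop) _ _ _ _) (cint2 (by fun_prop) _ _ _ _) fun p => ?_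
    simp only
    have h1 := hle p
    have h2 := sq_nonneg (c * |v p| - 3 * |w p|)
    have h3 := sq_abs (v p)
    have h4 := sq_abs (w p)
    have : 0 ≤ c ^ 2 * (vx p ^ 2 + vy p ^ 2) := by positivity
    have : (c * |v p| + 3 * |w p|) ^ 2 ≤ 2 * c ^ 2 * v p ^ 2 + 18 * w p ^ 2 := by
      rw [← h3, ← h4]; nlinarith
    nlinarith [sq_nonneg (v p)]
  have k1 := key vx hvx (fun p => by nlinarith [sq_nonneg (vy p)])
  have k2 := key vy hvy (fun p => by nlinarith [sq_nonneg (vx p)])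
  calc ∫ p, v p ^ 6 ∂((Jm a b).prod (Jm a b)) = ∫ p, (v p ^ 3) ^ 2 ∂((Jm a b).prod (Jm a b)) := by
        congr 1; ext p; ring
    _ ≤ _ := h
    _ ≤ Q := by
      refine (le_abs_self _).trans (abs_le_of_sq_le_sq ?_ hQ0)
      rw [mul_pow, sq Q]
      exact mul_le_mul k1 k2 (sq_nonneg _) hQ0

lemma sob3 (L : ℝ) (hL : 0 < L) : ∃ C > (0:ℝ), ∀ f fx fy ft g gx gy : (ℝ × ℝ) × ℝ → ℝ,
    Continuous f → Continuous fx → Continuous fy → Continuous ft →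
    Continuous g → Continuous gx → Continuous gy →
    (∀ x y t, HasDerivAt (fun s => f ((s, y), t)) (fx ((x, y), t)) x) →
    (∀ x y t, HasDerivAt (fun s => f ((x, s), t)) (fy ((x, y), t)) y) →
    (∀ x y t, HasDerivAt (fun s => f ((x, y), s)) (ft ((x, y), t)) t) →
    (∀ x y t, HasDerivAt (fun s => g ((s, y), t)) (gx ((x, y), t)) x) →
    (∀ x y t, HasDerivAt (fun s => g ((x, s), t)) (gy ((x, y), t)) y) →
    ∫ p, f p ^ 2 * g p ^ 2 ∂(((Jm (-L) L).prod (Jm (-L) L)).prod (Jm (-(1/2)) (1/2))) ≤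
     C * (∫ p, (f p ^ 2 + fx p ^ 2 + fy p ^ 2 + ft p ^ 2) ∂(((Jm (-L) L).prod (Jm (-L) L)).prod (Jm (-(1/2)) (1/2))))
      * (∫ p, (g p ^ 2 + gx p ^ 2 + gy p ^ 2) ∂(((Jm (-L) L).prod (Jm (-L) L)).prod (Jm (-(1/2)) (1/2)))) := by
  have hab : -L < L := by linarith
  set c := (L - -L)⁻¹ with hc
  have hc0 : 0 < c := by rw [hc]; apply inv_pos.2; linarith
  set κ := 2 * (c ^ 2 + 9) with hκ
  have hκ0 : 0 < κ := by positivity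
  set μ := (Jm (-L) L).prod (Jm (-L) L) with hμ
  set ν := Jm (-(1/2)) (1/2) with hν
  refine ⟨(34 * κ + 1) * (c + 1), by positivity, ?_⟩
  intro f fx fy ft g gx gy hf hfx hfy hft hg hgx hgy dfx dfy dft dgx dgy
  have ci : ∀ {F : (ℝ × ℝ) × ℝ → ℝ}, Continuous F → Integrable F (μ.prod ν) := 
    fun hF => cint3 hF _ _ _ _ _ _
  have ci2 : ∀ {F : ℝ × ℝ → ℝ}, Continuous F → Integrable F μ := fun hF => cint2 hF _ _ _ _
  set N := ∫ p, (f p ^ 2 + fx p ^ 2 + fy p ^ 2 + ft p ^ 2) ∂(μ.prod ν) with hN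
  have hN0 : 0 ≤ N := integral_nonneg fun p => by positivity
  set M := ∫ p, |f p| ^ 3 * (|f p| + 4 * |ft p|) ∂(μ.prod ν) with hM
  have hM0 : 0 ≤ M := integral_nonneg fun p => by positivity
  -- slices of f in L^4
  have hslice : ∀ t ∈ Icc (-(1/2) : ℝ) (1/2), ∫ p, f (p, t) ^ 4 ∂μ ≤ M := by
    intro t ht
    rw [hM, integral_prod _ (ci (by fun_prop))]
    refine integral_mono (ci2 (by fun_prop)) (Integrable.integral_prod_left (ci (F := fun p => |f p| ^ 3 * (|f p| + 4 * |ft p|)) (by fun_prop))) fun p => ?_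
    have h1 := oneD (by norm_num : (-(1/2) : ℝ) < 1/2) (u := fun s => f (p, s) ^ 4)
      (u' := fun s => 4 * f (p, s) ^ 3 * ft (p, s)) (by fun_prop) (by fun_prop)
      (fun s => by simpa using (dft p.1 p.2 s).fun_pow 4) ht
    refine (le_abs_self _).trans (h1.trans (le_of_eq ?_))
    congr 1; ext s
    rw [abs_pow, abs_mul, abs_mul, abs_pow, abs_of_pos (by norm_num : (0:ℝ) < 4)]
    norm_num
    ring
  have hK : ∫ p, f p ^ 6 ∂(μ.prod ν) ≤ κ * M * N := by
    have hE : ∫ p, (f p ^ 2 + fx p ^ 2 + fy p ^ 2) ∂(μ.prod ν) ≤ N :=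
      integral_mono (ci (by fun_prop)) (ci (by fun_prop)) fun p => by 
        simp only; nlinarith [sq_nonneg (ft p)]
    refine le_trans ?_ (mul_le_mul_of_nonneg_left hE (by positivity))
    rw [integral_prod_symm _ (ci (by fun_prop)), integral_prod_symm _ (ci (by fun_prop)), 
      ← integral_const_mul]
    refine setIntegral_mono_on (Integrable.integral_prod_right (ci (F := fun p => f p ^ 6) (by fun_prop)))
      (Integrable.const_mul (Integrable.integral_prod_right (ci (F := fun p => f p ^ 2 + fx p ^ 2 + fy p ^ 2) (by fun_prop))) _) measurableSet_Icc ?_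
    intro t ht
    have h6 := slice6 hab (v := fun p => f (p, t)) (vx := fun p => fx (p, t)) (vy := fun p => fy (p, t))
      (by fun_prop) (by fun_prop) (by fun_prop) (fun x y => dfx x y t) (fun x y => dfy x y t)
    refine h6.trans ?_
    refine mul_le_mul_of_nonneg_right ?_ (integral_nonneg fun p => by positivity)
    exact mul_le_mul_of_nonneg_left (hslice t ht) hκ0.le
  have hM2 : M ^ 2 ≤ (κ * M * N) * (34 * N) := by
    refine (cs_int _ _ _ (ci (by fun_prop)) (ci (by fun_prop)) (ci (by fun_prop))).trans ?_
    refine mul_le_mul (le_trans (le_of_eq ?_) hK) ?_ (integral_nonneg fun p => by positivity) (by positivity)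
    · congr 1; ext p
      rw [← pow_mul]
      exact Even.pow_abs (by decide) _
    · rw [hN, ← integral_const_mul]
      refine integral_mono (ci (by fun_prop)) (ci (by fun_prop)) fun p => ?_
      simp only
      have h3 := sq_abs (f p)
      have h4 := sq_abs (ft p)
      nlinarith [sq_nonneg (|f p| - 4 * |ft p|), sq_nonneg (fx p), sq_nonneg (fy p)]
  have hMN : M ≤ 34 * κ * N ^ 2 := by
    by_contra hcon
    push Not at hcon
    have : 0 ≤ 34 * κ * N ^ 2 := by positivity
    nlinarith
  rw [integral_prod_symm _ (ci (by fun_prop)), integral_prod_symm (fun p => g p ^ 2 + gx p ^ 2 + gy p ^ 2) (ci (by fun_prop)), 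
      ← integral_const_mul]
  refine setIntegral_mono_on (Integrable.integral_prod_right (ci (F := fun p => f p ^ 2 * g p ^ 2) (by fun_prop)))
      (Integrable.const_mul (Integrable.integral_prod_right (ci (F := fun p => g p ^ 2 + gx p ^ 2 + gy p ^ 2) (by fun_prop))) _) measurableSet_Icc ?_
  intro t ht
  have h4 := slice4 hab (v := fun p => g (p, t)) (vx := fun p => gx (p, t)) (vy := fun p => gy (p, t))
      (by fun_prop) (by fun_prop) (by fun_prop) (fun x y => dgx x y t) (fun x y => dgy x y t)
  have hG0 : 0 ≤ ∫ p, (g (p, t) ^ 2 + gx (p, t) ^ 2 + gy (p, t) ^ 2) ∂μ := integral_nonneg fun p => by positivity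
  set G := ∫ p, (g (p, t) ^ 2 + gx (p, t) ^ 2 + gy (p, t) ^ 2) ∂μ with hG
  have hcs := cs_int μ (fun p => f (p, t) ^ 2) (fun p => g (p, t) ^ 2) (ci2 (by fun_prop)) (ci2 (by fun_prop)) (ci2 (by fun_prop))
  have ef : ∫ p, (f (p, t) ^ 2) ^ 2 ∂μ ≤ 34 * κ * N ^ 2 := by
    refine le_trans (le_of_eq ?_) ((hslice t ht).trans hMN)
    congr 1; ext p; ring
  have eg : ∫ p, (g (p, t) ^ 2) ^ 2 ∂μ ≤ ((c + 1) * G) ^ 2 := by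
    refine le_trans (le_of_eq ?_) h4
    congr 1; ext p; ring
  refine (le_abs_self _).trans (abs_le_of_sq_le_sq ?_ (by positivity))
  refine hcs.trans ?_
  calc _ ≤ (34 * κ * N ^ 2) * ((c + 1) * G) ^ 2 := 
        mul_le_mul ef eg (integral_nonneg fun p => by positivity) (by positivity)
    _ ≤ ((34 * κ + 1) ^ 2 * N ^ 2) * ((c + 1) * G) ^ 2 := by
        gcongr; nlinarith
    _ = _ := by ring

/-- the flat tangential square -/
def Tset (n : ℕ) (L : ℝ) : Set (Fin n → ℝ) := {x' | ∀ i, x' i ∈ Ioo (-L) L}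

lemma tset_meas (n : ℕ) (L : ℝ) : MeasurableSet (Tset n L) := by
  have : Tset n L = Set.pi univ (fun _ => Ioo (-L) L) := by ext x; simp [Tset]
  rw [this]
  exact MeasurableSet.univ_pi fun _ => measurableSet_Ioo

lemma omega_int (n : ℕ) (L : ℝ) {F : (Fin n → ℝ) × ℝ → ℝ} (hF : Continuous F) :
    IntegrableOn F (Tset n L ×ˢ Iv) := by
  have hK : IsCompact ((Set.pi univ (fun _ : Fin n => Icc (-L) L)) ×ˢ Icc (-(1/2) : ℝ) (1/2)) :=
    (isCompact_univ_pi fun _ => isCompact_Icc).prod isCompact_Icc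
  refine (hF.continuousOn.integrableOn_compact hK).mono_set ?_
  rintro ⟨x, t⟩ ⟨hx, ht⟩
  exact ⟨fun i _ => Ioo_subset_Icc_self (hx i), Ioo_subset_Icc_self ht⟩

/-- transfer from the three-dimensional box -/
lemma transfer (n : ℕ) (L k : ℝ) (ψ : ℝ × ℝ → Fin n → ℝ) (hψ : Continuous ψ)
    (hslice : ∀ G : (Fin n → ℝ) → ℝ, Continuous G →
      ∫ p, G (ψ p) ∂((Jm (-L) L).prod (Jm (-L) L)) = k * ∫ x in Tset n L, G x)
    (F : (Fin n → ℝ) × ℝ → ℝ) (hF : Continuous F) :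
    ∫ p, F (ψ p.1, p.2) ∂(((Jm (-L) L).prod (Jm (-L) L)).prod (Jm (-(1/2)) (1/2))) =
      k * ∫ p in Tset n L ×ˢ Iv, F p := by
  rw [integral_prod_symm _ (cint3 (by fun_prop) _ _ _ _ _ _)]
  have h2 := omega_int n L hF
  rw [Measure.volume_eq_prod, IntegrableOn, ← Measure.prod_restrict] at h2
  rw [Measure.volume_eq_prod, ← Measure.prod_restrict, integral_prod_symm _ h2, ← integral_const_mul]
  have : Jm (-(1/2)) (1/2) = volume.restrict Iv := by
    unfold Jm Iv
    exact Measure.restrict_congr_set Ioo_ae_eq_Icc.symm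
  rw [this]
  congr 1; ext t
  exact hslice (fun x => F (x, t)) (by fun_prop)

lemma hint2 (L : ℝ) (G : (Fin 2 → ℝ) → ℝ) :
      ∫ p, G (![p.1, p.2]) ∂((Jm (-L) L).prod (Jm (-L) L)) = 1 * ∫ x in Tset 2 L, G x := by
  have e : Tset 2 L = (MeasurableEquiv.finTwoArrow (α := ℝ)) ⁻¹' (Ioo (-L) L ×ˢ Ioo (-L) L) := by
    ext x; simp [Tset, MeasurableEquiv.finTwoArrow]
  have := (volume_preserving_finTwoArrow ℝ).setIntegral_preimage_emb 
    (MeasurableEquiv.measurableEmbedding _) (fun p => G ![p.1, p.2]) (Ioo (-L) L ×ˢ Ioo (-L) L)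
  have hJ : Jm (-L) L = volume.restrict (Ioo (-L) L) := 
    Measure.restrict_congr_set Ioo_ae_eq_Icc.symm
  rw [one_mul, hJ, Measure.prod_restrict, ← Measure.volume_eq_prod, ← this, e]
  congr 1; ext x; congr 1; ext i; fin_cases i <;> rfl

lemma hint1 (L : ℝ) (hL : 0 < L) (G : (Fin 1 → ℝ) → ℝ) (hG : Continuous G) :
      ∫ p, G (fun _ => p.1) ∂((Jm (-L) L).prod (Jm (-L) L)) = (2 * L) * ∫ x in Tset 1 L, G x := by
  have e : Tset 1 L = (MeasurableEquiv.funUnique (Fin 1) ℝ) ⁻¹' (Ioo (-L) L) := by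
    ext x; simp [Tset, MeasurableEquiv.funUnique]
  have := (volume_preserving_funUnique (Fin 1) ℝ).setIntegral_preimage_emb 
    (MeasurableEquiv.measurableEmbedding _) (fun p => G fun _ => p) (Ioo (-L) L)
  have hJ : Jm (-L) L = volume.restrict (Ioo (-L) L) := 
    Measure.restrict_congr_set Ioo_ae_eq_Icc.symm
  have hJ' : (Jm (-L) L).real univ = 2 * L := by
    simp [Jm]; rw [max_eq_left] <;> linarith
  rw [integral_prod_symm _ (cint2 (by fun_prop) _ _ _ _)]
  simp only [integral_const, hJ', smul_eq_mul]
  rw [hJ, ← this, e]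
  congr 2; ext x; congr 1; ext i
  have : i = default := Subsingleton.elim _ _
  subst this; rfl

lemma sobn (n : ℕ) (hn : n = 1 ∨ n = 2) (L : ℝ) (hL : 0 < L) : ∃ C > (0:ℝ), 
    ∀ f g : (Fin n → ℝ) × ℝ → ℝ, ContDiff ℝ 1 f → ContDiff ℝ 1 g → 
    ∫ p in Tset n L ×ˢ Iv, f p ^ 2 * g p ^ 2 ≤
     C * (∫ p in Tset n L ×ˢ Iv, (f p ^ 2 + ∑ j, (fderiv ℝ f p (Pi.single j 1, 0)) ^ 2 + (fderiv ℝ f p (0, 1)) ^ 2))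
      * (∫ p in Tset n L ×ˢ Iv, (g p ^ 2 + ∑ j, (fderiv ℝ g p (Pi.single j 1, 0)) ^ 2)) := by
  obtain ⟨C, hC, hmain⟩ := sob3 L hL
  have hcomp : ∀ (f : (Fin n → ℝ) × ℝ → ℝ), ContDiff ℝ 1 f → ∀ (γ : ℝ → (Fin n → ℝ) × ℝ) (γ' : (Fin n → ℝ) × ℝ) (s : ℝ),
      HasDerivAt γ γ' s → HasDerivAt (fun s => f (γ s)) (fderiv ℝ f (γ s) γ') s := by
    intro f hf γ γ' s hγ
    exact ((hf.differentiable (by norm_num)) (γ s)).hasFDerivAt.comp_hasDerivAt s hγ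
  have hcf : ∀ (f : (Fin n → ℝ) × ℝ → ℝ), ContDiff ℝ 1 f → ∀ w, Continuous fun p => fderiv ℝ f p w := by
    intro f hf w
    exact (hf.continuous_fderiv (by norm_num)).clm_apply continuous_const
  rcases hn with rfl | rfl
  · refine ⟨C * (2 * L), by positivity, fun f g hf hg => ?_⟩
    have hψ : Continuous (fun p : ℝ × ℝ => (fun _ : Fin 1 => p.1)) := by fun_prop
    have tr := transfer 1 L (2 * L) (fun p _ => p.1) hψ (hint1 L hL)
    have hf0 := hf.continuous
    have hg0 := hg.continuous
    have c1 := hcf f hf (Pi.single 0 1, 0)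
    have c2 := hcf f hf (0, 1)
    have c3 := hcf g hg (Pi.single 0 1, 0)
    have dx : ∀ x t : ℝ, HasDerivAt (fun s : ℝ => ((fun _ : Fin 1 => s), t)) ((Pi.single 0 1 : Fin 1 → ℝ), (0:ℝ)) x := by
      intro x t
      refine HasDerivAt.prodMk (hasDerivAt_pi.2 fun i => ?_) (hasDerivAt_const _ _)
      have : i = 0 := Subsingleton.elim _ _
      subst this
      simpa using hasDerivAt_id' x
    have dt : ∀ (x : Fin 1 → ℝ) (t : ℝ), HasDerivAt (fun s : ℝ => (x, s)) ((0 : Fin 1 → ℝ), (1:ℝ)) t := fun x t =>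
      HasDerivAt.prodMk (hasDerivAt_const _ _) (hasDerivAt_id t)
    have h := hmain (fun p => f (fun _ => p.1.1, p.2)) (fun p => fderiv ℝ f (fun _ => p.1.1, p.2) (Pi.single 0 1, 0)) (fun _ => 0)
      (fun p => fderiv ℝ f (fun _ => p.1.1, p.2) (0, 1)) (fun p => g (fun _ => p.1.1, p.2))
      (fun p => fderiv ℝ g (fun _ => p.1.1, p.2) (Pi.single 0 1, 0)) (fun _ => 0)
      (by fun_prop) (c1.comp (by fun_prop)) continuous_const (c2.comp (by fun_prop)) (by fun_prop) (c3.comp (by fun_prop)) continuous_const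
      (fun x y t => hcomp f hf _ _ _ (dx x t)) (fun x y t => hasDerivAt_const y (f (fun _ => x, t))) (fun x y t => hcomp f hf _ _ _ (dt (fun _ => x) t))
      (fun x y t => hcomp g hg _ _ _ (dx x t)) (fun x y t => hasDerivAt_const y (g (fun _ => x, t)))
    rw [tr (fun p => f p ^ 2 * g p ^ 2) (by fun_prop),
      tr (fun p => f p ^ 2 + (fderiv ℝ f p (Pi.single 0 1, 0)) ^ 2 + 0 ^ 2 + (fderiv ℝ f p (0, 1)) ^ 2) (by fun_prop),
      tr (fun p => g p ^ 2 + (fderiv ℝ g p (Pi.single 0 1, 0)) ^ 2 + 0 ^ 2) (by fun_prop)] at h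
    simp only [Fin.sum_univ_one]
    norm_num at h
    refine le_of_mul_le_mul_left (h.trans (le_of_eq ?_)) (by positivity : 0 < 2 * L)
    ring
  · refine ⟨C, by positivity, fun f g hf hg => ?_⟩
    have hψ : Continuous (fun p : ℝ × ℝ => (![p.1, p.2] : Fin 2 → ℝ)) := by
      refine continuous_pi fun i => ?_
      fin_cases i <;> simp <;> fun_prop
    have tr := transfer 2 L 1 (fun p => ![p.1, p.2]) hψ (fun G _ => hint2 L G)
    have hf0 := hf.continuous
    have hg0 := hg.continuous
    have c1 := hcf f hf (Pi.single 0 1, 0)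
    have c1' := hcf f hf (Pi.single 1 1, 0)
    have c2 := hcf f hf (0, 1)
    have c3 := hcf g hg (Pi.single 0 1, 0)
    have c3' := hcf g hg (Pi.single 1 1, 0)
    have cψ : Continuous (fun p : (ℝ × ℝ) × ℝ => ((![p.1.1, p.1.2] : Fin 2 → ℝ), p.2)) :=
      (hψ.comp continuous_fst).prodMk continuous_snd
    have dx : ∀ x y t : ℝ, HasDerivAt (fun s : ℝ => ((![s, y] : Fin 2 → ℝ), t)) ((Pi.single 0 1 : Fin 2 → ℝ), (0:ℝ)) x := by
      intro x y t
      refine HasDerivAt.prodMk (hasDerivAt_pi.2 fun i => ?_) (hasDerivAt_const _ _)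
      fin_cases i
      · simpa using hasDerivAt_id' x
      · simpa using hasDerivAt_const x y
    have dy : ∀ x y t : ℝ, HasDerivAt (fun s : ℝ => ((![x, s] : Fin 2 → ℝ), t)) ((Pi.single 1 1 : Fin 2 → ℝ), (0:ℝ)) y := by
      intro x y t
      refine HasDerivAt.prodMk (hasDerivAt_pi.2 fun i => ?_) (hasDerivAt_const _ _)
      fin_cases i
      · simpa using hasDerivAt_const y x
      · simpa using hasDerivAt_id' y
    have dt : ∀ (x : Fin 2 → ℝ) (t : ℝ), HasDerivAt (fun s : ℝ => (x, s)) ((0 : Fin 2 → ℝ), (1:ℝ)) t := fun x t =>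
      HasDerivAt.prodMk (hasDerivAt_const _ _) (hasDerivAt_id t)
    have h := hmain (fun p => f (![p.1.1, p.1.2], p.2)) (fun p => fderiv ℝ f (![p.1.1, p.1.2], p.2) (Pi.single 0 1, 0))
      (fun p => fderiv ℝ f (![p.1.1, p.1.2], p.2) (Pi.single 1 1, 0))
      (fun p => fderiv ℝ f (![p.1.1, p.1.2], p.2) (0, 1)) (fun p => g (![p.1.1, p.1.2], p.2))
      (fun p => fderiv ℝ g (![p.1.1, p.1.2], p.2) (Pi.single 0 1, 0)) (fun p => fderiv ℝ g (![p.1.1, p.1.2], p.2) (Pi.single 1 1, 0))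
      (hf0.comp cψ) (c1.comp cψ) (c1'.comp cψ) (c2.comp cψ) (hg0.comp cψ) (c3.comp cψ) (c3'.comp cψ)
      (fun x y t => hcomp f hf _ _ _ (dx x y t)) (fun x y t => hcomp f hf _ _ _ (dy x y t)) (fun x y t => hcomp f hf _ _ _ (dt ![x, y] t))
      (fun x y t => hcomp g hg _ _ _ (dx x y t)) (fun x y t => hcomp g hg _ _ _ (dy x y t))
    rw [tr (fun p => f p ^ 2 * g p ^ 2) (by fun_prop),
      tr (fun p => f p ^ 2 + (fderiv ℝ f p (Pi.single 0 1, 0)) ^ 2 + (fderiv ℝ f p (Pi.single 1 1, 0)) ^ 2 + (fderiv ℝ f p (0, 1)) ^ 2) (by fun_prop),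
      tr (fun p => g p ^ 2 + (fderiv ℝ g p (Pi.single 0 1, 0)) ^ 2 + (fderiv ℝ g p (Pi.single 1 1, 0)) ^ 2) (by fun_prop)] at h
    simp only [Fin.sum_univ_two, ← add_assoc]
    simpa only [one_mul] using h

/-- entries of the rescaled matrix `h⁻¹ sym A + skew A`. -/
def ent (i k : Fin d) (A : Matrix (Fin d) (Fin d) ℝ) : ℝ :=
  h⁻¹ * (1 / 2 * (A i k + A k i)) + 1 / 2 * (A i k - A k i)

lemma hNorm_sq (A : Matrix (Fin d) (Fin d) ℝ) : hNorm d h A ^ 2 = ∑ i, ∑ k, ent d h i k A ^ 2 := by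
  have h1 := frobInner_nonneg d (symPart d A)
  have h2 := frobInner_nonneg d (skewPart d A)
  rw [hNorm, Real.sq_sqrt (by positivity)]
  have hz : ∑ i, ∑ k, (A i k + A k i) * (A i k - A k i) = 0 := by
    have e : ∑ i, ∑ k, (A i k + A k i) * (A i k - A k i) = ∑ i, ∑ k, (A k i + A i k) * (A k i - A i k) :=
      Finset.sum_comm
    have e2 : ∑ i, ∑ k, (A k i + A i k) * (A k i - A i k) = - ∑ i, ∑ k, (A i k + A k i) * (A i k - A k i) := by
      simp only [← Finset.sum_neg_distrib]
      refine Finset.sum_congr rfl fun i _ => Finset.sum_congr rfl fun k _ => by ring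
    linarith
  have e : ∀ i k, ent d h i k A ^ 2 = h⁻¹ ^ 2 * (symPart d A i k * symPart d A i k) +
      skewPart d A i k * skewPart d A i k + (h⁻¹ / 2) * ((A i k + A k i) * (A i k - A k i)) := by
    intro i k
    simp [ent, symPart, skewPart]
    ring
  simp only [e, Finset.sum_add_distrib, ← Finset.mul_sum, hz, frobInner]
  ring

lemma entry_contDiff {E : Type*} [NormedAddCommGroup E] [NormedSpace ℝ E] {Y : E → Matrix (Fin d) (Fin d) ℝ}
    (hY : ContDiff ℝ 1 Y) (i k : Fin d) : ContDiff ℝ 1 (fun p => Y p i k) :=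
  (LinearMap.toContinuousLinearMap (Matrix.entryLinearMap ℝ ℝ i k : Matrix (Fin d) (Fin d) ℝ →ₗ[ℝ] ℝ)).contDiff.comp hY

lemma ent_contDiff {E : Type*} [NormedAddCommGroup E] [NormedSpace ℝ E] {Y : E → Matrix (Fin d) (Fin d) ℝ}
    (hY : ContDiff ℝ 1 Y) (i k : Fin d) : ContDiff ℝ 1 (fun p => ent d h i k (Y p)) := by
  have h1 := entry_contDiff d hY i k
  have h2 := entry_contDiff d hY k i
  unfold ent
  fun_prop

lemma ent_fderiv {E : Type*} [NormedAddCommGroup E] [NormedSpace ℝ E] {Y : E → Matrix (Fin d) (Fin d) ℝ}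
    (hY : ContDiff ℝ 1 Y) (i k : Fin d) (p w : E) : 
    fderiv ℝ (fun p => ent d h i k (Y p)) p w = 
      ent d h i k (Matrix.of fun i k => fderiv ℝ (fun q => Y q i k) p w) := by
  have h1 := ((entry_contDiff d hY i k).differentiable (by norm_num) p).hasFDerivAt
  have h2 := ((entry_contDiff d hY k i).differentiable (by norm_num) p).hasFDerivAt
  have h3 := (((h1.add h2).const_mul (1/2)).const_mul h⁻¹).add ((h1.sub h2).const_mul (1/2))
  have h4 : HasFDerivAt (fun p => ent d h i k (Y p)) _ p := h3
  rw [h4.fderiv]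
  simp [ent]
  ring

lemma ent_cont {E : Type*} [TopologicalSpace E] {Y : E → Matrix (Fin d) (Fin d) ℝ}
    (hY : Continuous Y) (i k : Fin d) : Continuous (fun p => ent d h i k (Y p)) := by
  have h1 : Continuous (fun p => Y p i k) := hY.matrix_elem i k
  have h2 : Continuous (fun p => Y p k i) := hY.matrix_elem k i
  unfold ent
  fun_prop

lemma hNorm_cont {E : Type*} [TopologicalSpace E] {Y : E → Matrix (Fin d) (Fin d) ℝ}
    (hY : Continuous Y) : Continuous (fun p => hNorm d h (Y p)) := by
  have e : ∀ A, hNorm d h A = Real.sqrt (∑ i, ∑ k, ent d h i k A ^ 2) := by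
    intro A
    have h0 : 0 ≤ hNorm d h A := Real.sqrt_nonneg _
    rw [← hNorm_sq, Real.sqrt_sq h0]
  simp only [e]
  have := ent_cont d h hY
  fun_prop

lemma L2hSq_eq {X : Dom d → Matrix (Fin d) (Fin d) ℝ} 
    (hX : ∀ i k, Continuous fun p => ent d h i k (X p)) :
    L2hSq d L h X = ∑ i, ∑ k, ∫ p in OmegaSet d L, ent d h i k (X p) ^ 2 := by
  unfold L2hSq
  simp only [hNorm_sq]
  have hi : ∀ i k, Integrable (fun p => ent d h i k (X p) ^ 2) (volume.restrict (OmegaSet d L)) := 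
    fun i k => omega_int (d - 1) L ((hX i k).pow 2)
  rw [integral_finsetSum _ fun i _ => integrable_finsetSum _ fun k _ => hi i k]
  refine Finset.sum_congr rfl fun i _ => ?_
  rw [integral_finsetSum _ fun k _ => hi i k]

lemma H10_eq {Y : Dom d → Matrix (Fin d) (Fin d) ℝ} (hY : ContDiff ℝ 1 Y) :
    H10hSq d L h Y = ∑ i, ∑ k, ∫ p in OmegaSet d L, (ent d h i k (Y p) ^ 2 +
      ∑ j, (fderiv ℝ (fun p => ent d h i k (Y p)) p (Pi.single j 1, 0)) ^ 2) := by
  have hc : ∀ i k w, Continuous fun p => fderiv ℝ (fun p => ent d h i k (Y p)) p w := fun i k w =>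
    ((ent_contDiff d h hY i k).continuous_fderiv (by norm_num)).clm_apply continuous_const
  have hX : ∀ j i k, Continuous fun p => ent d h i k (dX d j Y p) := fun j i k => by
    have := hc i k (Pi.single j 1, 0)
    simp only [ent_fderiv d h hY] at this
    exact this
  have h0 : ∀ i k, Continuous fun p => ent d h i k (Y p) := fun i k => (ent_contDiff d h hY i k).continuous
  unfold H10hSq
  rw [L2hSq_eq d L h h0]
  simp only [L2hSq_eq d L h (hX _)]
  rw [Finset.sum_comm (s := (Finset.univ : Finset (Fin (d - 1)))), ← Finset.sum_add_distrib]
  refine Finset.sum_congr rfl fun i _ => ?_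
  rw [Finset.sum_comm (s := (Finset.univ : Finset (Fin (d - 1)))), ← Finset.sum_add_distrib]
  refine Finset.sum_congr rfl fun k _ => ?_
  have i1 : Integrable (fun p => ent d h i k (Y p) ^ 2) (volume.restrict (OmegaSet d L)) :=
    omega_int (d - 1) L ((h0 i k).pow 2)
  have i2 : ∀ j, Integrable (fun p => (fderiv ℝ (fun p => ent d h i k (Y p)) p (Pi.single j 1, 0)) ^ 2) 
      (volume.restrict (OmegaSet d L)) := fun j => omega_int (d - 1) L ((hc i k _).pow 2)
  rw [integral_add i1 (integrable_finsetSum _ fun j _ => i2 j), integral_finsetSum _ fun j _ => i2 j]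
  simp only [ent_fderiv d h hY]
  rfl

lemma H1_eq {Y : Dom d → Matrix (Fin d) (Fin d) ℝ} (hY : ContDiff ℝ 1 Y) :
    H1hSq d L h Y = ∑ i, ∑ k, ∫ p in OmegaSet d L, (ent d h i k (Y p) ^ 2 +
      ∑ j, (fderiv ℝ (fun p => ent d h i k (Y p)) p (Pi.single j 1, 0)) ^ 2
      + (fderiv ℝ (fun p => ent d h i k (Y p)) p (0, 1)) ^ 2) := by
  have hc : ∀ i k w, Continuous fun p => fderiv ℝ (fun p => ent d h i k (Y p)) p w := fun i k w =>
    ((ent_contDiff d h hY i k).continuous_fderiv (by norm_num)).clm_apply continuous_const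
  have hX : ∀ i k, Continuous fun p => ent d h i k (dN d Y p) := fun i k => by
    have := hc i k (0, 1)
    simp only [ent_fderiv d h hY] at this
    exact this
  have h0 : ∀ i k, Continuous fun p => ent d h i k (Y p) := fun i k => (ent_contDiff d h hY i k).continuous
  have e : H1hSq d L h Y = H10hSq d L h Y + L2hSq d L h (dN d Y) := rfl
  rw [e, H10_eq d L h hY, L2hSq_eq d L h hX, ← Finset.sum_add_distrib]
  refine Finset.sum_congr rfl fun i _ => ?_
  rw [← Finset.sum_add_distrib]
  refine Finset.sum_congr rfl fun k _ => ?_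
  have i1 : Integrable (fun p => ent d h i k (Y p) ^ 2 + ∑ j, (fderiv ℝ (fun p => ent d h i k (Y p)) p (Pi.single j 1, 0)) ^ 2)
      (volume.restrict (OmegaSet d L)) :=
    omega_int (d - 1) L (((h0 i k).pow 2).add (continuous_finsetSum _ fun j _ => (hc i k _).pow 2))
  have i2 : Integrable (fun p => (fderiv ℝ (fun p => ent d h i k (Y p)) p (0, 1)) ^ 2) 
      (volume.restrict (OmegaSet d L)) := omega_int (d - 1) L ((hc i k _).pow 2)
  rw [integral_add i1 i2]
  simp only [ent_fderiv d h hY]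
  rfl

theorem stmt15 (hd : d = 2 ∨ d = 3) (hL : 0 < L)
    (r : ℝ) (hr : 0 < r)
    (W : Matrix (Fin d) (Fin d) ℝ → ℝ)
    (hW : ContDiffOn ℝ (⊤ : ℕ∞) W (Metric.ball (1 : Matrix (Fin d) (Fin d) ℝ) r))
    (hframe : ∀ R F : Matrix (Fin d) (Fin d) ℝ, Rᵀ * R = 1 → R.det = 1 →
      F ∈ Metric.ball (1 : Matrix (Fin d) (Fin d) ℝ) r →
      R * F ∈ Metric.ball (1 : Matrix (Fin d) (Fin d) ℝ) r →
      W (R * F) = W F) :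
    ∃ ε > (0 : ℝ), ∃ C > (0 : ℝ), ∀ h : ℝ, 0 < h → h ≤ 1 →
      ∀ Z Y₁ Y₂ Y₃ : Dom d → Matrix (Fin d) (Fin d) ℝ,
        Continuous Z → ContDiff ℝ 1 Y₁ → ContDiff ℝ 1 Y₂ → Continuous Y₃ →
        (∀ p ∈ OmegaSet d L, frobNorm d (Z p) ≤ min ε h) →
        (∫ p in OmegaSet d L,
            |iteratedFDeriv ℝ 3 (fun G => W (1 + G)) (Z p) ![Y₁ p, Y₂ p, Y₃ p]|)
          ≤ C * h * Real.sqrt (H1hSq d L h Y₁) * Real.sqrt (H10hSq d L h Y₂)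
              * Real.sqrt (L2hSq d L h Y₃) := by
  obtain ⟨ε, hε, C₀, hC₀, hpt⟩ := pointwise d r hr W hW hframe
  obtain ⟨C₁, hC₁, hsob⟩ := sobn (d - 1) (by omega) L hL
  refine ⟨ε, hε, C₀ * Real.sqrt C₁, by positivity, ?_⟩
  intro h hh h1 Z Y₁ Y₂ Y₃ hZ hY₁ hY₂ hY₃ hZb
  have n1 := hNorm_cont d h hY₁.continuous
  have n2 := hNorm_cont d h hY₂.continuous
  have n3 := hNorm_cont d h hY₃
  have ci : ∀ {F : Dom d → ℝ}, Continuous F → Integrable F (volume.restrict (OmegaSet d L)) :=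
    fun hF => omega_int (d - 1) L hF
  have hmeas : MeasurableSet (OmegaSet d L) := (tset_meas (d - 1) L).prod measurableSet_Ioo
  have s1 : (∫ p in OmegaSet d L,
      |iteratedFDeriv ℝ 3 (fun G => W (1 + G)) (Z p) ![Y₁ p, Y₂ p, Y₃ p]|) ≤
      ∫ p in OmegaSet d L, C₀ * h * (hNorm d h (Y₁ p) * hNorm d h (Y₂ p) * hNorm d h (Y₃ p)) := by
    refine integral_mono_of_nonneg (Filter.Eventually.of_forall fun _ => abs_nonneg _)
      (ci (by fun_prop)) ?_
    refine (ae_restrict_iff' hmeas).2 (Filter.Eventually.of_forall fun p hp => ?_)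
    exact hpt h hh h1 _ _ _ _ (hZb p hp)
  have hf := ent_contDiff d h hY₁
  have hg := ent_contDiff d h hY₂
  have s2 : ∫ p in OmegaSet d L, (hNorm d h (Y₁ p) * hNorm d h (Y₂ p)) ^ 2 ≤
      C₁ * H1hSq d L h Y₁ * H10hSq d L h Y₂ := by
    have hfc : ∀ i k, Continuous (fun p => ent d h i k (Y₁ p)) := fun i k => (hf i k).continuous
    have hgc : ∀ i k, Continuous (fun p => ent d h i k (Y₂ p)) := fun i k => (hg i k).continuous
    have hi : ∀ i k l m, Integrable (fun p => ent d h i k (Y₁ p) ^ 2 * ent d h l m (Y₂ p) ^ 2)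
        (volume.restrict (OmegaSet d L)) := fun i k l m => ci (((hfc i k).pow 2).mul ((hgc l m).pow 2))
    have e : ∀ p, (hNorm d h (Y₁ p) * hNorm d h (Y₂ p)) ^ 2 = ∑ i, ∑ k, ∑ l, ∑ m,
        ent d h i k (Y₁ p) ^ 2 * ent d h l m (Y₂ p) ^ 2 := by
      intro p
      rw [mul_pow, hNorm_sq, hNorm_sq]
      simp only [Finset.sum_mul]
      simp only [Finset.mul_sum]
    simp only [e]
    rw [integral_finsetSum _ fun i _ => integrable_finsetSum _ fun k _ =>
      integrable_finsetSum _ fun l _ => integrable_finsetSum _ fun m _ => hi i k l m]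
    rw [H1_eq d L h hY₁, H10_eq d L h hY₂]
    rw [mul_assoc, Finset.sum_mul, Finset.mul_sum]
    refine Finset.sum_le_sum fun i _ => ?_
    rw [integral_finsetSum _ fun k _ =>
      integrable_finsetSum _ fun l _ => integrable_finsetSum _ fun m _ => hi i k l m,
      Finset.sum_mul, Finset.mul_sum]
    refine Finset.sum_le_sum fun k _ => ?_
    rw [integral_finsetSum _ fun l _ => integrable_finsetSum _ fun m _ => hi i k l m,
      Finset.mul_sum, Finset.mul_sum]
    refine Finset.sum_le_sum fun l _ => ?_
    rw [integral_finsetSum _ fun m _ => hi i k l m, Finset.mul_sum, Finset.mul_sum]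
    refine Finset.sum_le_sum fun m _ => ?_
    rw [← mul_assoc]
    exact hsob _ _ (hf i k) (hg l m)
  have l2n : ∀ X, 0 ≤ L2hSq d L h X := fun X => integral_nonneg fun p => sq_nonneg _
  have p1 : 0 ≤ H10hSq d L h Y₂ := add_nonneg (l2n _) (Finset.sum_nonneg fun j _ => l2n _)
  have p2 : 0 ≤ H1hSq d L h Y₁ :=
    add_nonneg (add_nonneg (l2n _) (Finset.sum_nonneg fun j _ => l2n _)) (l2n _)
  have s3 := cs_int (volume.restrict (OmegaSet d L)) (fun p => hNorm d h (Y₁ p) * hNorm d h (Y₂ p))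
    (fun p => hNorm d h (Y₃ p)) (ci (by fun_prop)) (ci (by fun_prop)) (ci (by fun_prop))
  have s4 : ∫ p in OmegaSet d L, hNorm d h (Y₁ p) * hNorm d h (Y₂ p) * hNorm d h (Y₃ p) ≤
      Real.sqrt (C₁ * H1hSq d L h Y₁ * H10hSq d L h Y₂ * L2hSq d L h Y₃) := by
    refine Real.le_sqrt_of_sq_le (s3.trans ?_)
    exact mul_le_mul_of_nonneg_right s2 (l2n _)
  rw [Real.sqrt_mul (by positivity), Real.sqrt_mul (by positivity), Real.sqrt_mul hC₁.le] at s4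
  rw [integral_const_mul] at s1
  refine s1.trans ((mul_le_mul_of_nonneg_left s4 (by positivity)).trans (le_of_eq ?_))
  ring
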